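/- arXiv:2510.01894 — 4 statements merged into one kernel-verified Lean document; each statement's English description precedes it below -/
import Mathlib

section
/- Let Ω = C([0,T], ℝ^d) be the space of continuous paths equipped with its Borel σ-algebra, let Q be a σ-finite measure on Ω, let 0 = t₀ < t₁ < ⋯ < t_K = T be a fixed time grid, and let μ₀, …, μ_K be probability measures on ℝ^d. Consider the feasible set A of probability measures P on Ω such that P is absolutely continuous with respect to Q and the pushforward of P under the evaluation map ω ↦ ω(t_i) equals μ_i for every i = 0, …, K. If P₁ and P₂ both belong to A and both attain the (finite) infimum of the Kullback–Leibler divergence KL(·‖Q) over A, then P₁ = P₂. (Uniqueness part of the existence-and-uniqueness proposition for the multi-marginal Schrödinger bridge.) -/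
open MeasureTheory
open scoped Classical

/-- Kullback–Leibler divergence: `∫ log (dμ/dν) dμ` when `μ ≪ ν` (and the
log-likelihood ratio is integrable), `+∞` otherwise. -/
noncomputable def KL {Ω : Type*} [MeasurableSpace Ω] (μ ν : Measure Ω) : EReal :=
  if μ ≪ ν ∧ Integrable (llr μ ν) μ then ((∫ x, llr μ ν x ∂μ : ℝ) : EReal) else ⊤

/-- The path space `C([0,T], ℝ^d)` with the uniform topology. -/
abbrev PathSpace (d : ℕ) (T : ℝ) := C(Set.Icc (0 : ℝ) T, EuclideanSpace ℝ (Fin d))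

/-- Borel σ-algebra on the path space. -/
noncomputable instance (d : ℕ) (T : ℝ) : MeasurableSpace (PathSpace d T) := borel _

instance (d : ℕ) (T : ℝ) : BorelSpace (PathSpace d T) := ⟨rfl⟩

open scoped ENNReal NNReal

/-- Pointwise lower bound used for integrability of the midpoint entropy. -/
lemma mid_lower (a b : ℝ) (ha : 0 ≤ a) (hb : 0 ≤ b) :
    2⁻¹ * (a * Real.log a) + 2⁻¹ * (b * Real.log b) - Real.log 2 * (2⁻¹ * a + 2⁻¹ * b)
      ≤ (2⁻¹ * a + 2⁻¹ * b) * Real.log (2⁻¹ * a + 2⁻¹ * b) := by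
  have key : ∀ x y : ℝ, 0 ≤ x → 0 ≤ y →
      x * Real.log x - Real.log 2 * x ≤ x * Real.log (2⁻¹ * x + 2⁻¹ * y) := by
    intro x y hx hy
    rcases hx.eq_or_lt with h | h
    · simp [← h]
    · have : Real.log (x / 2) ≤ Real.log (2⁻¹ * x + 2⁻¹ * y) :=
        Real.log_le_log (by positivity) (by linarith)
      rw [Real.log_div h.ne' (by norm_num)] at this
      nlinarith
  have h1 := key a b ha hb
  have h2 := key b a hb ha
  rw [add_comm (2⁻¹ * b)] at h2
  nlinarith

lemma mid_upper (a b : ℝ) (ha : 0 ≤ a) (hb : 0 ≤ b) :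
    (2⁻¹ * a + 2⁻¹ * b) * Real.log (2⁻¹ * a + 2⁻¹ * b) ≤
      2⁻¹ * (a * Real.log a) + 2⁻¹ * (b * Real.log b) :=
  Real.convexOn_mul_log.2 ha hb
    (show (0:ℝ) ≤ 2⁻¹ by norm_num) (show (0:ℝ) ≤ 2⁻¹ by norm_num) (by norm_num)

lemma mid_strict (a b : ℝ) (ha : 0 ≤ a) (hb : 0 ≤ b)
    (h : (2⁻¹ * a + 2⁻¹ * b) * Real.log (2⁻¹ * a + 2⁻¹ * b) =
      2⁻¹ * (a * Real.log a) + 2⁻¹ * (b * Real.log b)) : a = b := by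
  by_contra hne
  exact (Real.strictConvexOn_mul_log.2 ha hb hne
    (show (0:ℝ) < 2⁻¹ by norm_num) (show (0:ℝ) < 2⁻¹ by norm_num) (by norm_num)).ne h

lemma KL_lt_top {Ω : Type*} [MeasurableSpace Ω] {μ ν : Measure Ω} (h : KL μ ν < ⊤) :
    μ ≪ ν ∧ Integrable (llr μ ν) μ := by
  by_contra hc
  simp [KL, hc] at h

lemma KL_eq {Ω : Type*} [MeasurableSpace Ω] {μ ν : Measure Ω}
    (h : μ ≪ ν ∧ Integrable (llr μ ν) μ) :
    KL μ ν = ((∫ x, llr μ ν x ∂μ : ℝ) : EReal) := by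
  simp [KL, h]

lemma eq_of_mid {Ω : Type*} [MeasurableSpace Ω] (Q P₁ P₂ : Measure Ω) [SigmaFinite Q]
    [IsProbabilityMeasure P₁] [IsProbabilityMeasure P₂]
    (h₁ : KL P₁ Q < ⊤) (h₁₂ : KL P₂ Q = KL P₁ Q)
    (hm : KL P₁ Q ≤ KL ((2⁻¹ : ℝ≥0) • P₁ + (2⁻¹ : ℝ≥0) • P₂) Q) : P₁ = P₂ := by
  have H₁ := KL_lt_top h₁
  have H₂ := KL_lt_top (h₁₂ ▸ h₁)
  rw [KL_eq H₁, KL_eq H₂] at h₁₂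
  rw [KL_eq H₁] at hm
  set M := (2⁻¹ : ℝ≥0) • P₁ + (2⁻¹ : ℝ≥0) • P₂ with hM
  have hac : M ≪ Q := Measure.AbsolutelyContinuous.add_left
    (H₁.1.smul_left _) (H₂.1.smul_left _)
  have hrn : ∀ᵐ x ∂Q, (M.rnDeriv Q x).toReal =
      2⁻¹ * (P₁.rnDeriv Q x).toReal + 2⁻¹ * (P₂.rnDeriv Q x).toReal := by
    filter_upwards [Measure.rnDeriv_add ((2⁻¹ : ℝ≥0) • P₁) ((2⁻¹ : ℝ≥0) • P₂) Q,
      Measure.rnDeriv_smul_left P₁ Q (2⁻¹ : ℝ≥0), Measure.rnDeriv_smul_left P₂ Q (2⁻¹ : ℝ≥0),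
      P₁.rnDeriv_lt_top Q, P₂.rnDeriv_lt_top Q] with x hx h1 h2 l1 l2
    rw [hx, Pi.add_apply, h1, h2, Pi.smul_apply, Pi.smul_apply, ENNReal.toReal_add]
    · simp [ENNReal.smul_def]
    · rw [ENNReal.smul_def, smul_eq_mul]; exact ENNReal.mul_ne_top ENNReal.coe_ne_top l1.ne
    · rw [ENNReal.smul_def, smul_eq_mul]; exact ENNReal.mul_ne_top ENNReal.coe_ne_top l2.ne
  have i1 := (integrable_rnDeriv_mul_log_iff H₁.1).2 H₁.2
  have i2 := (integrable_rnDeriv_mul_log_iff H₂.1).2 H₂.2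
  have e1 := integral_rnDeriv_mul_log H₁.1
  have e2 := integral_rnDeriv_mul_log H₂.1
  have eM := integral_rnDeriv_mul_log hac
  have r1 : Integrable (fun x => (P₁.rnDeriv Q x).toReal) Q := Measure.integrable_toReal_rnDeriv
  have r2 : Integrable (fun x => (P₂.rnDeriv Q x).toReal) Q := Measure.integrable_toReal_rnDeriv
  have iu : Integrable (fun x => 2⁻¹ * ((P₁.rnDeriv Q x).toReal * Real.log (P₁.rnDeriv Q x).toReal)
      + 2⁻¹ * ((P₂.rnDeriv Q x).toReal * Real.log (P₂.rnDeriv Q x).toReal)) Q :=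
    (i1.const_mul _).add (i2.const_mul _)
  have il := iu.sub (((r1.const_mul 2⁻¹).add (r2.const_mul 2⁻¹)).const_mul (Real.log 2))
  have hle : ∀ᵐ x ∂Q, (M.rnDeriv Q x).toReal * Real.log (M.rnDeriv Q x).toReal ≤
      2⁻¹ * ((P₁.rnDeriv Q x).toReal * Real.log (P₁.rnDeriv Q x).toReal)
      + 2⁻¹ * ((P₂.rnDeriv Q x).toReal * Real.log (P₂.rnDeriv Q x).toReal) := by
    filter_upwards [hrn] with x hx
    rw [hx]
    exact mid_upper _ _ ENNReal.toReal_nonneg ENNReal.toReal_nonneg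
  have iM : Integrable
      (fun x => (M.rnDeriv Q x).toReal * Real.log (M.rnDeriv Q x).toReal) Q := by
    refine integrable_of_le_of_le ?_ ?_ hle il iu
    · have : Measurable (fun x => (M.rnDeriv Q x).toReal) :=
        (Measure.measurable_rnDeriv M Q).ennreal_toReal
      exact (this.mul this.log).aestronglyMeasurable
    · filter_upwards [hrn] with x hx
      rw [hx]
      exact mid_lower _ _ ENNReal.toReal_nonneg ENNReal.toReal_nonneg
  have HM : M ≪ Q ∧ Integrable (llr M Q) M := ⟨hac, (integrable_rnDeriv_mul_log_iff hac).1 iM⟩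
  rw [KL_eq HM, EReal.coe_le_coe_iff] at hm
  rw [EReal.coe_eq_coe_iff] at h₁₂
  have heq := (integral_eq_iff_of_ae_le iM iu hle).1 (le_antisymm (integral_mono_ae iM iu hle) (by
    rw [integral_add (i1.const_mul _) (i2.const_mul _), integral_const_mul, integral_const_mul]
    simp only [llr] at *
    rw [e1, e2, eM]; linarith))
  have hfin : P₁.rnDeriv Q =ᵐ[Q] P₂.rnDeriv Q := by
    filter_upwards [hrn, heq, P₁.rnDeriv_lt_top Q, P₂.rnDeriv_lt_top Q] with x hx he l1 l2
    simp only [hx] at he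
    exact (ENNReal.toReal_eq_toReal_iff' l1.ne l2.ne).1
      (mid_strict _ _ ENNReal.toReal_nonneg ENNReal.toReal_nonneg he)
  rw [← Measure.withDensity_rnDeriv_eq P₁ Q H₁.1, ← Measure.withDensity_rnDeriv_eq P₂ Q H₂.1]
  exact withDensity_congr_ae hfin

/-- Uniqueness of the multi-marginal Schrödinger bridge: two minimizers of
`KL(·‖Q)` over the feasible set of probability measures on path space that are
absolutely continuous w.r.t. `Q` and have the prescribed time marginals must
coincide, provided the infimum is finite. -/
theorem mmsb_uniqueness (d K : ℕ) (T : ℝ) (hT : 0 < T)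
    (Q : Measure (PathSpace d T)) (hQ : SigmaFinite Q)
    (t : Fin (K + 1) → ℝ) (ht_mono : StrictMono t)
    (ht0 : t 0 = 0) (htK : t (Fin.last K) = T)
    (ht_mem : ∀ i, t i ∈ Set.Icc (0 : ℝ) T)
    (μ : Fin (K + 1) → Measure (EuclideanSpace ℝ (Fin d)))
    (hμ : ∀ i, IsProbabilityMeasure (μ i))
    (A : Set (Measure (PathSpace d T)))
    (hA : A = {P | IsProbabilityMeasure P ∧ P ≪ Q ∧
      ∀ i, P.map (fun ω => ω ⟨t i, ht_mem i⟩) = μ i})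
    (P₁ P₂ : Measure (PathSpace d T)) (hP₁ : P₁ ∈ A) (hP₂ : P₂ ∈ A)
    (hfin : (⨅ P ∈ A, KL P Q) < ⊤)
    (hmin₁ : KL P₁ Q = ⨅ P ∈ A, KL P Q)
    (hmin₂ : KL P₂ Q = ⨅ P ∈ A, KL P Q) :
    P₁ = P₂ := by
  have hP₁' := hP₁
  have hP₂' := hP₂
  rw [hA] at hP₁' hP₂'
  obtain ⟨p1, a1, m1⟩ := hP₁'
  obtain ⟨p2, a2, m2⟩ := hP₂'
  refine eq_of_mid Q P₁ P₂ (hmin₁ ▸ hfin) (hmin₂.trans hmin₁.symm) ?_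
  rw [hmin₁]
  have half : (2⁻¹ : ℝ≥0∞) + 2⁻¹ = 1 := ENNReal.inv_two_add_inv_two
  have hc : ((2⁻¹ : ℝ≥0) : ℝ≥0∞) = 2⁻¹ := by simp
  refine iInf₂_le _ ?_
  rw [hA]
  refine ⟨⟨?_⟩, Measure.AbsolutelyContinuous.add_left (a1.smul_left _) (a2.smul_left _), ?_⟩
  · simp [ENNReal.smul_def, hc, half]
  · intro i
    have hmeas : Measurable (fun ω : PathSpace d T => ω ⟨t i, ht_mem i⟩) :=
      (continuous_eval_const _).measurable
    rw [Measure.map_add _ _ hmeas, Measure.map_smul, Measure.map_smul, m1 i, m2 i, ← add_smul]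
    have : (2⁻¹ : ℝ≥0) + 2⁻¹ = 1 := by norm_num
    rw [this, one_smul]
end

section
/- Let ν be a σ-finite measure on a measurable space, and let μ₁ ≠ μ₂ be two probability measures on the same space, each absolutely continuous with respect to ν and each with finite Kullback–Leibler divergence with respect to ν. Then for every t ∈ (0,1), KL(t·μ₁ + (1−t)·μ₂ ‖ ν) < t·KL(μ₁‖ν) + (1−t)·KL(μ₂‖ν). (Strict convexity of the Kullback–Leibler divergence in its first argument, used to prove uniqueness of the multi-marginal Schrödinger bridge.) -/
open MeasureTheory
open scoped Classical

lemma KL_aux_pt (t a b : ℝ) (ht0 : 0 < t) (ht1 : t < 1) (ha : 0 ≤ a) (hb : 0 ≤ b) :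
    t * (a * Real.log a + Real.log t * a) + (1 - t) * (b * Real.log b + Real.log (1 - t) * b)
      ≤ (t * a + (1 - t) * b) * Real.log (t * a + (1 - t) * b) := by
  have h1t : 0 < 1 - t := by linarith
  have key : ∀ s c d : ℝ, 0 < s → 0 ≤ c → 0 ≤ d →
      s * (c * Real.log c + Real.log s * c) ≤ s * c * Real.log (s * c + d) := by
    intro s c d hs hc hd
    rcases hc.eq_or_lt with rfl | hc
    · simp
    · have h : Real.log s + Real.log c ≤ Real.log (s * c + d) := by
        rw [← Real.log_mul hs.ne' hc.ne']
        exact Real.log_le_log (by positivity) (by linarith)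
      have := mul_le_mul_of_nonneg_left h (by positivity : 0 ≤ s * c)
      linarith
  have h1 := key t a ((1 - t) * b) ht0 ha (by positivity)
  have h2 := key (1 - t) b (t * a) h1t hb (by positivity)
  rw [add_comm ((1 - t) * b)] at h2
  linarith

theorem kl_strictly_convex {Ω : Type*} [MeasurableSpace Ω]
    (ν : Measure Ω) [SigmaFinite ν]
    (μ₁ μ₂ : Measure Ω) [IsProbabilityMeasure μ₁] [IsProbabilityMeasure μ₂]
    (hne : μ₁ ≠ μ₂) (hac₁ : μ₁ ≪ ν) (hac₂ : μ₂ ≪ ν)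
    (hfin₁ : KL μ₁ ν < ⊤) (hfin₂ : KL μ₂ ν < ⊤)
    (t : ℝ) (ht : t ∈ Set.Ioo (0 : ℝ) 1) :
    KL (ENNReal.ofReal t • μ₁ + ENNReal.ofReal (1 - t) • μ₂) ν
      < (t : EReal) * KL μ₁ ν + ((1 - t : ℝ) : EReal) * KL μ₂ ν := by
  obtain ⟨ht0, ht1⟩ := ht
  have h1t : 0 < 1 - t := by linarith
  have hI₁ : μ₁ ≪ ν ∧ Integrable (llr μ₁ ν) μ₁ := by
    by_contra h
    simp [KL, h] at hfin₁
  have hI₂ : μ₂ ≪ ν ∧ Integrable (llr μ₂ ν) μ₂ := by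
    by_contra h
    simp [KL, h] at hfin₂
  set μ := ENNReal.ofReal t • μ₁ + ENNReal.ofReal (1 - t) • μ₂ with hμ
  have hfin_t : IsFiniteMeasure (ENNReal.ofReal t • μ₁) := μ₁.smul_finite ENNReal.ofReal_ne_top
  have hfin_t' : IsFiniteMeasure (ENNReal.ofReal (1 - t) • μ₂) :=
    μ₂.smul_finite ENNReal.ofReal_ne_top
  have hfinμ : IsFiniteMeasure μ := by rw [hμ]; infer_instance
  have hac : μ ≪ ν :=
    Measure.AbsolutelyContinuous.add_left (hac₁.smul_left _) (hac₂.smul_left _)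
  have hF : ∀ (m : Measure Ω) [IsFiniteMeasure m], m ≪ ν →
      (Integrable (fun x => (m.rnDeriv ν x).toReal * Real.log (m.rnDeriv ν x).toReal) ν ↔
        Integrable (llr m ν) m) ∧
      ∫ x, (m.rnDeriv ν x).toReal * Real.log (m.rnDeriv ν x).toReal ∂ν = ∫ x, llr m ν x ∂m := by
    intro m _ hm
    exact ⟨integrable_rnDeriv_smul_iff hm (f := llr m ν), integral_rnDeriv_smul hm (f := llr m ν)⟩
  set f := fun x => (μ₁.rnDeriv ν x).toReal with hf
  set g := fun x => (μ₂.rnDeriv ν x).toReal with hg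
  have hfi : Integrable f ν := Measure.integrable_toReal_rnDeriv
  have hgi : Integrable g ν := Measure.integrable_toReal_rnDeriv
  have hφf : Integrable (fun x => f x * Real.log (f x)) ν := (hF μ₁ hac₁).1.2 hI₁.2
  have hφg : Integrable (fun x => g x * Real.log (g x)) ν := (hF μ₂ hac₂).1.2 hI₂.2
  have hh : (fun x => (μ.rnDeriv ν x).toReal) =ᵐ[ν] fun x => t * f x + (1 - t) * g x := by
    filter_upwards [Measure.rnDeriv_add (ENNReal.ofReal t • μ₁) (ENNReal.ofReal (1 - t) • μ₂) ν,
      Measure.rnDeriv_smul_left_of_ne_top μ₁ ν (ENNReal.ofReal_ne_top (r := t)),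
      Measure.rnDeriv_smul_left_of_ne_top μ₂ ν (ENNReal.ofReal_ne_top (r := 1 - t)),
      Measure.rnDeriv_ne_top μ₁ ν, Measure.rnDeriv_ne_top μ₂ ν] with x h1 h2 h3 h4 h5
    rw [h1, Pi.add_apply, h2, h3]
    simp only [Pi.smul_apply, smul_eq_mul]
    rw [ENNReal.toReal_add (ENNReal.mul_ne_top ENNReal.ofReal_ne_top h4)
      (ENNReal.mul_ne_top ENNReal.ofReal_ne_top h5), ENNReal.toReal_mul, ENNReal.toReal_mul,
      ENNReal.toReal_ofReal ht0.le, ENNReal.toReal_ofReal h1t.le]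
  have hφh_eq : (fun x => (μ.rnDeriv ν x).toReal * Real.log (μ.rnDeriv ν x).toReal) =ᵐ[ν]
      fun x => (t * f x + (1 - t) * g x) * Real.log (t * f x + (1 - t) * g x) := by
    filter_upwards [hh] with x hx
    rw [hx]
  have hf0 : ∀ x, 0 ≤ f x := fun x => ENNReal.toReal_nonneg
  have hg0 : ∀ x, 0 ≤ g x := fun x => ENNReal.toReal_nonneg
  have hfm : Measurable f := (Measure.measurable_rnDeriv _ _).ennreal_toReal
  have hgm : Measurable g := (Measure.measurable_rnDeriv _ _).ennreal_toReal
  have hle : ∀ x, (t * f x + (1 - t) * g x) * Real.log (t * f x + (1 - t) * g x) ≤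
      t * (f x * Real.log (f x)) + (1 - t) * (g x * Real.log (g x)) := fun x => by
    simpa using Real.strictConvexOn_mul_log.convexOn.2 (hf0 x) (hg0 x) ht0.le h1t.le (by ring)
  have hUi : Integrable (fun x => t * (f x * Real.log (f x)) + (1 - t) * (g x * Real.log (g x))) ν :=
    (hφf.const_mul _).add (hφg.const_mul _)
  have hφh : Integrable
      (fun x => (t * f x + (1 - t) * g x) * Real.log (t * f x + (1 - t) * g x)) ν := by
    refine integrable_of_le_of_le (by fun_prop)
      (Filter.Eventually.of_forall fun x => KL_aux_pt t (f x) (g x) ht0 ht1 (hf0 x) (hg0 x))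
      (Filter.Eventually.of_forall hle) ?_ hUi
    exact ((hφf.add (hfi.const_mul _)).const_mul _).add ((hφg.add (hgi.const_mul _)).const_mul _)
  have hI : μ ≪ ν ∧ Integrable (llr μ ν) μ :=
    ⟨hac, (hF μ hac).1.1 ((integrable_congr hφh_eq).2 hφh)⟩
  have hlt : ∫ x, (t * f x + (1 - t) * g x) * Real.log (t * f x + (1 - t) * g x) ∂ν <
      ∫ x, (t * (f x * Real.log (f x)) + (1 - t) * (g x * Real.log (g x))) ∂ν := by
    refine lt_of_le_of_ne (integral_mono hφh hUi hle) fun heq => hne ?_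
    have hae := (integral_eq_iff_of_ae_le hφh hUi (Filter.Eventually.of_forall hle)).1 heq
    rw [← Measure.withDensity_rnDeriv_eq μ₁ ν hac₁, ← Measure.withDensity_rnDeriv_eq μ₂ ν hac₂]
    refine withDensity_congr_ae ?_
    filter_upwards [hae, Measure.rnDeriv_ne_top μ₁ ν, Measure.rnDeriv_ne_top μ₂ ν] with x hx h4 h5
    rw [← ENNReal.toReal_eq_toReal_iff' h4 h5]
    by_contra hfg
    have := Real.strictConvexOn_mul_log.2 (hf0 x) (hg0 x) hfg ht0 h1t (by ring)
    simp only [smul_eq_mul] at this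
    exact this.ne hx
  rw [integral_add (hφf.const_mul _) (hφg.const_mul _), integral_const_mul, integral_const_mul,
    (hF μ₁ hac₁).2, (hF μ₂ hac₂).2, ← integral_congr_ae hφh_eq, (hF μ hac).2] at hlt
  rw [KL, KL, KL, if_pos hI, if_pos hI₁, if_pos hI₂]
  exact_mod_cast hlt
end

section
/- Let α and β be standard Borel spaces, let P be a probability measure on α × β, let κ be a Markov kernel from α to β, and let γ be a probability measure on α. Let Π⋆ = P.fst ⊗ κ be the composition-product of the first marginal of P with κ, and let Π = γ ⊗ κ. If KL(P‖Π) < ∞, then KL(P‖Π) = KL(P‖Π⋆) + KL(Π⋆‖Π). (Pythagorean identity for the factorized reciprocal projection, reciprocal part of the Pythagorean lemma.) -/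
open MeasureTheory ProbabilityTheory
open scoped Classical

open InformationTheory in
lemma KL_eq_klDiv {Ω : Type*} [MeasurableSpace Ω] (μ ν : Measure Ω)
    [IsProbabilityMeasure μ] [IsProbabilityMeasure ν] :
    KL μ ν = ((klDiv μ ν : ENNReal) : EReal) := by
  unfold KL
  split_ifs with h
  · rw [← toReal_klDiv_of_measure_eq h.1 (by simp)]
    exact EReal.coe_ennreal_toReal (klDiv_ne_top h.1 h.2)
  · have : klDiv μ ν = ⊤ := by
      rw [klDiv_eq_top_iff]; tauto
    simp [this]

/-- Pythagorean identity for the factorized reciprocal projection: for a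
probability measure `P` on `α × β`, a Markov kernel `κ` from `α` to `β` and a
probability measure `γ` on `α`, letting `Π⋆ = P.fst ⊗ₘ κ` and `Π = γ ⊗ₘ κ`, if
`KL(P‖Π) < ∞` then `KL(P‖Π) = KL(P‖Π⋆) + KL(Π⋆‖Π)`. -/
theorem kl_pythagorean_reciprocal {α β : Type*}
    [MeasurableSpace α] [MeasurableSpace β]
    [StandardBorelSpace α] [StandardBorelSpace β]
    (P : Measure (α × β)) [IsProbabilityMeasure P]
    (κ : Kernel α β) [IsMarkovKernel κ]
    (γ : Measure α) [IsProbabilityMeasure γ]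
    (hfin : KL P (γ ⊗ₘ κ) < ⊤) :
    KL P (γ ⊗ₘ κ) = KL P (P.fst ⊗ₘ κ) + KL (P.fst ⊗ₘ κ) (γ ⊗ₘ κ) := by
  have : Nonempty β := by
    obtain ⟨x⟩ := Measure.nonempty_of_neZero P
    exact ⟨x.2⟩
  simp only [KL_eq_klDiv]
  rw [← EReal.coe_ennreal_add, add_comm, InformationTheory.klDiv_compProd_left]
  conv_lhs => rw [← P.disintegrate P.condKernel]
  rw [InformationTheory.klDiv_compProd_eq_add, P.disintegrate P.condKernel]
end

section
/- Let α₀, …, α_K be standard Borel spaces, E = α₀ × ⋯ × α_K, and Q a probability measure on E. Let f_i : α_i → (0, ∞) be measurable functions, and let π be a probability measure on E with π ≪ Q and Radon–Nikodym derivative dπ/dQ(x₀,…,x_K) = ∏_{i=0}^{K} f_i(x_i). Let μ_i denote the i-th coordinate marginal of π, and assume ∫ |log f_i| dμ_i < ∞ for every i. Then for every probability measure π′ on E with π′ ≪ Q, with the same coordinate marginals μ₀, …, μ_K, and with KL(π′‖Q) < ∞, one has KL(π‖Q) ≤ KL(π′‖Q); that is, a measure whose density with respect to the reference coupling factorizes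 as a product of single-coordinate potentials is the entropic projection of Q onto the set of couplings with its marginals. (Sufficiency direction of the factorized form of the static multi-marginal Schrödinger bridge solution.) -/
open MeasureTheory
open scoped Classical

/-- Sufficiency direction of the factorized form of the static multi-marginal
Schrödinger bridge solution: if `π ≪ Q` has density `dπ/dQ(x₀,…,x_K)` equal to
a product `∏ᵢ fᵢ(xᵢ)` of positive single-coordinate potentials, with
`log fᵢ` integrable against the `i`-th marginal `μᵢ` of `π`, then `π`
minimizes `KL(·‖Q)` among all couplings `π′ ≪ Q` with the same coordinate
marginals and finite KL divergence. -/
theorem factorized_density_is_entropic_projection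
    (K : ℕ) (α : Fin (K + 1) → Type*)
    [∀ i, MeasurableSpace (α i)] [∀ i, StandardBorelSpace (α i)]
    (Q : Measure ((i : Fin (K + 1)) → α i)) [IsProbabilityMeasure Q]
    (f : (i : Fin (K + 1)) → α i → ℝ)
    (hf_meas : ∀ i, Measurable (f i)) (hf_pos : ∀ i x, 0 < f i x)
    (π : Measure ((i : Fin (K + 1)) → α i)) [IsProbabilityMeasure π]
    (hπQ : π ≪ Q)
    (hdens : π.rnDeriv Q =ᵐ[Q] fun x => ENNReal.ofReal (∏ i, f i (x i)))
    (μ : (i : Fin (K + 1)) → Measure (α i))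
    (hμ : ∀ i, μ i = π.map fun x => x i)
    (hlog : ∀ i, Integrable (fun y => Real.log (f i y)) (μ i)) :
    ∀ π' : Measure ((i : Fin (K + 1)) → α i), IsProbabilityMeasure π' →
      π' ≪ Q → (∀ i, π'.map (fun x => x i) = μ i) → KL π' Q < ⊤ →
      KL π Q ≤ KL π' Q := by
  intro π' hπ' hac hmarg hfin
  set F : ((i : Fin (K + 1)) → α i) → ℝ := fun x => ∑ i, Real.log (f i (x i)) with hF
  have hexp : ∀ x, Real.exp (F x) = ∏ i, f i (x i) := by
    intro x
    simp only [hF, Real.exp_sum]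
    exact Finset.prod_congr rfl fun i _ => Real.exp_log (hf_pos i _)
  have hprod : ∀ x : (i : Fin (K + 1)) → α i, 0 ≤ ∏ i, f i (x i) := fun x =>
    Finset.prod_nonneg fun i _ => (hf_pos i _).le
  -- integrability and integral for measures with the given marginals
  have hmain : ∀ ρ : Measure ((i : Fin (K + 1)) → α i),
      (∀ i, ρ.map (fun x => x i) = μ i) →
      Integrable F ρ ∧ ∫ x, F x ∂ρ = ∑ i, ∫ y, Real.log (f i y) ∂(μ i) := by
    intro ρ hρ
    have h1 : ∀ i, Integrable (fun x : (i : Fin (K + 1)) → α i => Real.log (f i (x i))) ρ := by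
      intro i
      have h := hlog i
      rw [← hρ i] at h
      exact h.comp_measurable (measurable_pi_apply i)
    refine ⟨integrable_finsetSum _ fun i _ => h1 i, ?_⟩
    rw [hF, integral_finsetSum _ fun i _ => h1 i]
    refine Finset.sum_congr rfl fun i _ => ?_
    rw [← hρ i, integral_map (measurable_pi_apply i).aemeasurable]
    exact ((hf_meas i).log).aestronglyMeasurable
  obtain ⟨hFπ, hIπ⟩ := hmain π fun i => (hμ i).symm
  obtain ⟨hFπ', hIπ'⟩ := hmain π' hmarg
  have hrn : (fun x => (π.rnDeriv Q x).toReal) =ᵐ[Q] fun x => Real.exp (F x) := by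
    filter_upwards [hdens] with x hx
    rw [hx, ENNReal.toReal_ofReal (hprod x), hexp]
  have hllr : llr π Q =ᵐ[π] F := by
    refine hπQ.ae_le ?_
    filter_upwards [hrn] with x hx
    rw [llr, hx, Real.log_exp]
  have hexpInt : Integrable (fun x => Real.exp (F x)) Q :=
    (integrable_congr hrn).1 Measure.integrable_toReal_rnDeriv
  have hexpOne : ∫ x, Real.exp (F x) ∂Q = 1 := by
    rw [← integral_congr_ae hrn, Measure.integral_toReal_rnDeriv hπQ]
    simp
  have hint' : π' ≪ Q ∧ Integrable (llr π' Q) π' := by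
    by_contra h
    rw [KL, if_neg h] at hfin
    exact lt_irrefl _ hfin
  have hπint : Integrable (llr π Q) π := (integrable_congr hllr).2 hFπ
  rw [KL, if_pos ⟨hπQ, hπint⟩, KL, if_pos hint', EReal.coe_le_coe_iff,
    integral_congr_ae hllr, hIπ, ← hIπ']
  have hT := integral_llr_tilted_right hac hFπ' hexpInt hint'.2
  have hTint := integrable_llr_tilted_right hac hFπ' hint'.2 hexpInt
  have : IsProbabilityMeasure (Q.tilted F) := isProbabilityMeasure_tilted hexpInt
  have hG := InformationTheory.integral_llr_add_sub_measure_univ_nonneg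
    (hac.trans (absolutelyContinuous_tilted hexpInt)) hTint
  rw [hT, hexpOne] at hG
  simp at hG
  linarith
end
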